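/- The maps f : X → Z defined by f(xi) = zi for i = 0,1,2, f(a0) = k0, f(a1) = f(a2) = k2, f(a3) = k3, f(a4) = k4, and g : Y → Z defined by g(yi) = zi for i = 0,1,2, g(b0) = g(b1) = k0, g(b2) = k2, g(b3) = k3, g(b4) = k4, are surjective FS-morphisms. -/

import Mathlib

/-- An FS-frame: a poset (le) with a binary relation R satisfying the
Fischer-Servi confluence conditions F1 and F2. -/
structure IsFSFrame {α : Type*} (le R : α → α → Prop) : Prop where
  refl : ∀ a, le a a
  trans : ∀ a b c, le a b → le b c → le a c
  antisymm : ∀ a b, le a b → le b a → a = b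
  F1 : ∀ x x' y, le x x' → R x y → ∃ y', R x' y' ∧ le y y'
  F2 : ∀ x y y', R x y → le y y' → ∃ x', le x x' ∧ R x' y'

/-- An FS-morphism between FS-frames. -/
structure IsFSMorphism {α β : Type*} (leX RX : α → α → Prop)
    (leY RY : β → β → Prop) (f : α → β) : Prop where
  mono : ∀ a b, leX a b → leY (f a) (f b)
  le_back : ∀ a z, leY (f a) z → ∃ a', leX a a' ∧ f a' = z
  forth : ∀ a b, RX a b → RY (f a) (f b)
  weak_back : ∀ a z, RY (f a) z → ∃ a', RX a a' ∧ leY z (f a')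
  strong_back : ∀ a m z, leY (f a) m → RY m z →
    ∃ a' a'', leX a a' ∧ RX a' a'' ∧ leY (f a'') z


/-- The underlying set of the frame X. -/
inductive XF : Type
  | x0 | x1 | x2 | a0 | a1 | a2 | a3 | a4
deriving DecidableEq

/-- The partial order on X generated by x0 ≤ x2, x0 ≤ a3, x0 ≤ a4, x1 ≤ a0,
x1 ≤ a2, together with reflexivity (transitivity adds nothing new). -/
def Xle : XF → XF → Prop := fun a b => a = b ∨
  (a = .x0 ∧ (b = .x2 ∨ b = .a3 ∨ b = .a4)) ∨
  (a = .x1 ∧ (b = .a0 ∨ b = .a2))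

/-- The relation R on X. -/
def XR : XF → XF → Prop := fun a b =>
  (a = .x0 ∧ b = .x1) ∨ (a = .x2 ∧ b = .a0) ∨ (a = .x2 ∧ b = .a1) ∨
  (a = .a3 ∧ b = .a0) ∨ (a = .a4 ∧ b = .a2)

/-- The underlying set of the frame Y. -/
inductive YF : Type
  | y0 | y1 | y2 | b0 | b1 | b2 | b3 | b4
deriving DecidableEq

/-- The partial order on Y generated by y0 ≤ y2, y0 ≤ b3, y0 ≤ b4, y1 ≤ b0,
y1 ≤ b2, together with reflexivity. -/
def Yle : YF → YF → Prop := fun a b => a = b ∨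
  (a = .y0 ∧ (b = .y2 ∨ b = .b3 ∨ b = .b4)) ∨
  (a = .y1 ∧ (b = .b0 ∨ b = .b2))

/-- The relation R on Y. -/
def YR : YF → YF → Prop := fun a b =>
  (a = .y0 ∧ b = .y1) ∨ (a = .y2 ∧ b = .b1) ∨ (a = .y2 ∧ b = .b2) ∨
  (a = .b3 ∧ b = .b0) ∨ (a = .b4 ∧ b = .b2)

/-- The underlying set of the frame Z. -/
inductive ZF : Type
  | z0 | z1 | z2 | k0 | k2 | k3 | k4
deriving DecidableEq

/-- The partial order on Z generated by z0 ≤ z2, z0 ≤ k3, z0 ≤ k4, z1 ≤ k0,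
z1 ≤ k2, together with reflexivity. -/
def Zle : ZF → ZF → Prop := fun a b => a = b ∨
  (a = .z0 ∧ (b = .z2 ∨ b = .k3 ∨ b = .k4)) ∨
  (a = .z1 ∧ (b = .k0 ∨ b = .k2))

/-- The relation R on Z. -/
def ZR : ZF → ZF → Prop := fun a b =>
  (a = .z0 ∧ b = .z1) ∨ (a = .z2 ∧ b = .k0) ∨ (a = .z2 ∧ b = .k2) ∨
  (a = .k3 ∧ b = .k0) ∨ (a = .k4 ∧ b = .k2)

/-- The map f : X → Z. -/
def fXZ : XF → ZF
  | .x0 => .z0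
  | .x1 => .z1
  | .x2 => .z2
  | .a0 => .k0
  | .a1 => .k2
  | .a2 => .k2
  | .a3 => .k3
  | .a4 => .k4

/-- The map g : Y → Z. -/
def gYZ : YF → ZF
  | .y0 => .z0
  | .y1 => .z1
  | .y2 => .z2
  | .b0 => .k0
  | .b1 => .k0
  | .b2 => .k2
  | .b3 => .k3
  | .b4 => .k4


instance : Fintype XF where
  elems := {.x0, .x1, .x2, .a0, .a1, .a2, .a3, .a4}
  complete a := by cases a <;> decide

instance : Fintype YF where
  elems := {.y0, .y1, .y2, .b0, .b1, .b2, .b3, .b4}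
  complete a := by cases a <;> decide

instance : Fintype ZF where
  elems := {.z0, .z1, .z2, .k0, .k2, .k3, .k4}
  complete a := by cases a <;> decide

instance : DecidableRel Xle := fun a b => by
  unfold Xle
  infer_instance

instance : DecidableRel XR := fun a b => by
  unfold XR
  infer_instance

instance : DecidableRel Yle := fun a b => by
  unfold Yle
  infer_instance

instance : DecidableRel YR := fun a b => by
  unfold YR
  infer_instance

instance : DecidableRel Zle := fun a b => by
  unfold Zle
  infer_instance

instance : DecidableRel ZR := fun a b => by
  unfold ZR
  infer_instance

/-- the maps f : X → Z and g : Y → Z are surjective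
FS-morphisms. -/
theorem f_g_surjective_FS_morphisms :
    IsFSMorphism Xle XR Zle ZR fXZ ∧ Function.Surjective fXZ ∧
    IsFSMorphism Yle YR Zle ZR gYZ ∧ Function.Surjective gYZ := by
  refine ⟨⟨?_, ?_, ?_, ?_, ?_⟩, ?_, ⟨?_, ?_, ?_, ?_, ?_⟩, ?_⟩
  all_goals decide
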